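/- Let (ℝ^m, 0, g_E, |x|²/4) be the Gaussian soliton with m ≥ 4, and let g̃ = e^{−|x|²/(2(m−2))} g_E be the conformally changed metric. Then there is a constant L > 0 such that for every x ∈ ℝ^m with |x| > L, the points x and −x cannot be connected by a minimizing geodesic in (ℝ^m, g̃). -/

import Mathlib

/-!
STATEMENT 6 (Proposition `prn:PE27_1`):
Let `(ℝ^m, 0, g_E, |x|²/4)` be the Gaussian soliton (`m ≥ 4`) and let
`g̃ = e^{-|x|²/(2(m-2))} g_E` be the conformally changed metric.  Then there is
`L > 0` such that for every `x` with `|x| > L`, the points `x` and `-x` cannot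
be joined by a minimizing geodesic of `(ℝ^m, g̃)`.

The conformal metric is formalized through its length functional: the
`g̃`-length of a `C¹` curve `γ` is `∫₀¹ e^{-‖γ(t)‖²/(4(m-2))} ‖γ'(t)‖ dt`
(the conformal factor on lengths is the square root of the factor on the
metric), and the `g̃`-distance is the infimum of the lengths of `C¹` curves
joining the two points.  A minimizing geodesic from `x` to `y` is a `C¹` curve
from `x` to `y` whose `g̃`-length equals the `g̃`-distance.
-/

open Metric MeasureTheory Filter Set intervalIntegral

noncomputable section

/-- the conformal weight `e^{-‖x‖²/(4(m-2))}` on tangent vectors, i.e. the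
square root of the conformal factor `e^{-‖x‖²/(2(m-2))}` of `g̃`. -/
def confWeight (m : ℕ) (x : EuclideanSpace ℝ (Fin m)) : ℝ :=
  Real.exp (-‖x‖ ^ 2 / (4 * ((m : ℝ) - 2)))

/-- the `g̃`-length of a curve `γ : [0,1] → ℝ^m`. -/
def confLength (m : ℕ) (γ : ℝ → EuclideanSpace ℝ (Fin m)) : ℝ :=
  ∫ t in (0 : ℝ)..1, confWeight m (γ t) * ‖deriv γ t‖

/-- the `g̃`-distance between `x` and `y`: the infimum of `g̃`-lengths of `C¹`
curves joining them. -/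
def confDist (m : ℕ) (x y : EuclideanSpace ℝ (Fin m)) : ℝ :=
  ⨅ γ : {γ : ℝ → EuclideanSpace ℝ (Fin m) // ContDiff ℝ 1 γ ∧ γ 0 = x ∧ γ 1 = y},
    confLength m γ.1

lemma aux_fence {V : Type*} [NormedAddCommGroup V] [NormedSpace ℝ V] {f f' : ℝ → V} {g : ℝ → ℝ}
    {p q : ℝ} (hpq : p ≤ q) (hg : Continuous g)
    (hf : ∀ t ∈ Icc p q, HasDerivAt f (f' t) t) (hb : ∀ t ∈ Icc p q, ‖f' t‖ ≤ g t) :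
    ‖f q - f p‖ ≤ ∫ t in p..q, g t := by
  have hB : ∀ x, HasDerivAt (fun u => ∫ t in p..u, g t) (g x) x := fun x =>
    intervalIntegral.integral_hasDerivAt_right (hg.intervalIntegrable _ _)
      (hg.stronglyMeasurableAtFilter _ _) hg.continuousAt
  exact image_norm_le_of_norm_deriv_right_le_deriv_boundary (f := fun t => f t - f p) (f' := f')
    (fun t ht => ((hf t ht).sub_const _).continuousAt.continuousWithinAt)
    (fun t ht => ((hf t (Ico_subset_Icc_self ht)).sub_const _).hasDerivWithinAt)
    (by simp) hB (fun t ht => hb t (Ico_subset_Icc_self ht)) (right_mem_Icc.2 hpq)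

lemma aux_upper {D D' g : ℝ → ℝ} {p q : ℝ} (hpq : p ≤ q) (hg : Continuous g)
    (hD : ∀ t ∈ Icc p q, HasDerivAt D (D' t) t) (hb : ∀ t ∈ Icc p q, g t ≤ D' t) :
    ∫ t in p..q, g t ≤ D q - D p := by
  apply intervalIntegral.integral_le_sub_of_hasDeriv_right_of_le hpq
    (fun t ht => (hD t ht).continuousAt.continuousWithinAt)
    (fun t ht => (hD t (Ioo_subset_Icc_self ht)).hasDerivWithinAt)
    (hg.integrableOn_Icc) (fun t ht => hb t (Ioo_subset_Icc_self ht))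

def auxW (a r : ℝ) : ℝ := Real.exp (-a * r ^ 2)
def auxF (a r : ℝ) : ℝ := ∫ s in (0:ℝ)..r, auxW a s
def auxG (a r : ℝ) : ℝ := (∫ s in Ioi (0:ℝ), auxW a s) - auxF a r

lemma auxW_pos (a r : ℝ) : 0 < auxW a r := Real.exp_pos _

lemma auxW_cont (a : ℝ) : Continuous (auxW a) := by unfold auxW; fun_prop

lemma auxW_deriv (a r : ℝ) : HasDerivAt (auxW a) (-2 * a * r * auxW a r) r := by
  have := (((hasDerivAt_id r).pow 2).const_mul (-a)).exp
  exact this.congr_deriv (by simp [auxW]; ring)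

lemma auxF_deriv (a r : ℝ) : HasDerivAt (auxF a) (auxW a r) r :=
  intervalIntegral.integral_hasDerivAt_right ((auxW_cont a).intervalIntegrable _ _)
      ((auxW_cont a).stronglyMeasurableAtFilter _ _) (auxW_cont a).continuousAt

lemma auxG_deriv (a r : ℝ) : HasDerivAt (auxG a) (-auxW a r) r :=
  (auxF_deriv a r).const_sub _

lemma auxG_lim {a : ℝ} (ha : 0 < a) : Tendsto (auxG a) atTop (nhds 0) := by
  have h := intervalIntegral_tendsto_integral_Ioi (0:ℝ)
    (integrable_exp_neg_mul_sq ha).integrableOn tendsto_id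
  have := h.const_sub (∫ s in Ioi (0:ℝ), auxW a s)
  have e : (∫ s in Ioi (0:ℝ), auxW a s) - ∫ x in Ioi (0:ℝ), Real.exp (-a * x ^ 2) = 0 := sub_self _
  rw [e] at this
  exact this

lemma auxrW_lim {a : ℝ} (ha : 0 < a) : Tendsto (fun r => r * auxW a r) atTop (nhds 0) := by
  have h1 : Tendsto (fun r : ℝ => a⁻¹ * r⁻¹) atTop (nhds 0) := by
    simpa using tendsto_inv_atTop_zero.const_mul a⁻¹
  refine squeeze_zero' ?_ ?_ h1
  · filter_upwards [eventually_gt_atTop 0] with r hr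
    exact (mul_pos hr (auxW_pos a r)).le
  · filter_upwards [eventually_gt_atTop 0] with r hr
    have h2 : a * r ^ 2 ≤ Real.exp (a * r ^ 2) := by linarith [Real.add_one_le_exp (a * r ^ 2)]
    have h3 : 0 < a * r ^ 2 := by positivity
    have : auxW a r = (Real.exp (a * r ^ 2))⁻¹ := by
      rw [← Real.exp_neg]; unfold auxW; ring_nf
    rw [this]
    calc r * (Real.exp (a * r ^ 2))⁻¹ ≤ r * (a * r ^ 2)⁻¹ := by gcongr
      _ = a⁻¹ * r⁻¹ := by field_simp

lemma auxG_anti (a : ℝ) : StrictAnti (auxG a) := by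
  apply strictAnti_of_deriv_neg
  intro r
  rw [(auxG_deriv a r).deriv]
  linarith [auxW_pos a r]

lemma auxG_pos {a : ℝ} (ha : 0 < a) (r : ℝ) : 0 < auxG a r :=
  lt_of_le_of_lt ((auxG_anti a).antitone.le_of_tendsto (auxG_lim ha) (r+1))
    (auxG_anti a (by linarith))

lemma auxG_le {a : ℝ} (ha : 0 < a) {r : ℝ} (h0 : 0 < r) (hr : 1 ≤ a * r ^ 2) :
    auxG a r ≤ r * auxW a r := by
  have hd : ∀ s, HasDerivAt (fun s => s * auxW a s - auxG a s)
      (2 * auxW a s * (1 - a * s ^ 2)) s := by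
    intro s
    exact (((hasDerivAt_id s).mul (auxW_deriv a s)).sub (auxG_deriv a s)).congr_deriv
      (by simp; ring)
  have anti : AntitoneOn (fun s => s * auxW a s - auxG a s) (Ici r) := by
    apply antitoneOn_of_deriv_nonpos (convex_Ici r)
      (fun s _ => (hd s).continuousAt.continuousWithinAt)
      (fun s _ => (hd s).differentiableAt.differentiableWithinAt)
    intro s hs
    rw [interior_Ici] at hs
    rw [(hd s).deriv]
    have : a * r ^ 2 ≤ a * s ^ 2 := by
      have : r < s := hs
      gcongr
    have := auxW_pos a s
    apply mul_nonpos_of_nonneg_of_nonpos <;> linarith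
  have hl : Tendsto (fun s => s * auxW a s - auxG a s) atTop (nhds 0) := by
    simpa using (auxrW_lim ha).sub (auxG_lim ha)
  have : 0 ≤ r * auxW a r - auxG a r := by
    refine le_of_tendsto hl ?_
    filter_upwards [eventually_ge_atTop r] with s hs
    exact anti self_mem_Ici hs hs
  linarith

section lower
variable {V : Type*} [NormedAddCommGroup V] [InnerProductSpace ℝ V]

lemma auxW_norm_cont {a : ℝ} {γ : ℝ → V} (hγ : ContDiff ℝ 1 γ) :
    Continuous (fun t => auxW a ‖γ t‖ * ‖deriv γ t‖) :=
  ((auxW_cont a).comp hγ.continuous.norm).mul (hγ.continuous_deriv le_rfl).norm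

/-- radial bound for curves entering the core -/
lemma aux_core {a : ℝ} (ha : 0 < a) (ha4 : a ≤ 4) {γ : ℝ → V} (hγ : ContDiff ℝ 1 γ) {p q : ℝ}
    (hpq : p ≤ q) :
    |auxW (2*a) ‖γ q‖ / 4 - auxW (2*a) ‖γ p‖ / 4| ≤ ∫ t in p..q, auxW a ‖γ t‖ * ‖deriv γ t‖ := by
  have hd : ∀ t, HasDerivAt (fun t => auxW (2*a) ‖γ t‖ / 4)
      (-(a * inner ℝ (γ t) (deriv γ t) * auxW (2*a) ‖γ t‖)) t := by
    intro t
    have h1 := ((hγ.differentiable one_ne_zero) t).hasDerivAt.norm_sq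
    have h2 := ((h1.const_mul (-(2*a))).exp).div_const 4
    exact h2.congr_deriv (by simp [auxW]; ring)
  refine aux_fence hpq (auxW_norm_cont hγ) (fun t _ => hd t) ?_
  intro t _
  rw [norm_neg, norm_mul, norm_mul, Real.norm_of_nonneg ha.le,
    Real.norm_of_nonneg (auxW_pos _ _).le]
  have h1 := norm_inner_le_norm (𝕜 := ℝ) (γ t) (deriv γ t)
  set r := ‖γ t‖
  have hr : 0 ≤ r := norm_nonneg _
  have h2 : auxW (2*a) r = auxW a r * auxW a r := by
    unfold auxW; rw [← Real.exp_add]; ring_nf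
  have h3 : a * r * auxW a r ≤ 1 := by
    have e : auxW a r = (Real.exp (a * r ^ 2))⁻¹ := by
      rw [← Real.exp_neg]; unfold auxW; ring_nf
    rw [e, ← div_eq_mul_inv, div_le_one (Real.exp_pos _)]
    have := Real.add_one_le_exp (a * r ^ 2)
    have : a * r ≤ a * r ^ 2 + 1 := by nlinarith [sq_nonneg (r - 1/2), mul_nonneg ha.le (sq_nonneg (r - 1/2))]
    linarith
  have hw := auxW_pos a r
  rw [h2]
  calc a * ‖inner ℝ (γ t) (deriv γ t)‖ * (auxW a r * auxW a r)
      ≤ a * (r * ‖deriv γ t‖) * (auxW a r * auxW a r) := by gcongr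
    _ = (a * r * auxW a r) * (auxW a r * ‖deriv γ t‖) := by ring
    _ ≤ 1 * (auxW a r * ‖deriv γ t‖) := by gcongr
    _ = _ := one_mul _

/-- the contraction -/
def auxPhi (a : ℝ) (y : V) : V := (auxG a ‖y‖ / ‖y‖) • y

lemma auxPhi_norm {a : ℝ} (ha : 0 < a) {y : V} (hy : y ≠ 0) : ‖auxPhi a y‖ = auxG a ‖y‖ := by
  unfold auxPhi
  have : 0 < ‖y‖ := norm_pos_iff.2 hy
  rw [norm_smul, Real.norm_of_nonneg (div_pos (auxG_pos ha _) this).le]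
  field_simp

lemma aux_outer {a : ℝ} (ha : 0 < a) {γ : ℝ → V} (hγ : ContDiff ℝ 1 γ) {p q : ℝ}
    (hpq : p ≤ q) (hr : ∀ t ∈ Icc p q, 1 ≤ a * ‖γ t‖ ^ 2) :
    ‖auxPhi a (γ q) - auxPhi a (γ p)‖ ≤ ∫ t in p..q, auxW a ‖γ t‖ * ‖deriv γ t‖ := by
  set d : ℝ → ℝ := fun t => inner ℝ (γ t) (deriv γ t) / ‖γ t‖ with hdd
  have hpos : ∀ t ∈ Icc p q, 0 < ‖γ t‖ := by
    intro t ht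
    have := hr t ht
    rcases (norm_nonneg (γ t)).eq_or_lt with h | h
    · rw [← h] at this; norm_num at this
    · exact h
  have hd : ∀ t ∈ Icc p q, HasDerivAt (fun t => auxPhi a (γ t))
      ((auxG a ‖γ t‖ / ‖γ t‖) • deriv γ t + ((-auxW a ‖γ t‖ * d t * ‖γ t‖ - auxG a ‖γ t‖ * d t)
        / ‖γ t‖ ^ 2) • γ t) t := by
    intro t ht
    have h0 := hpos t ht
    have hγd := ((hγ.differentiable one_ne_zero) t).hasDerivAt
    have h1 : HasDerivAt (fun t => ‖γ t‖) (d t) t := by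
      have := hγd.norm_sq.sqrt (by simp; exact norm_pos_iff.1 h0)
      simp only [Real.sqrt_sq (norm_nonneg _)] at this
      convert this using 1
      simp only [hdd]; field_simp
    have h2 := (auxG_deriv a ‖γ t‖).comp t h1
    exact (h2.div h1 h0.ne').smul hγd
  refine aux_fence hpq (auxW_norm_cont hγ) hd ?_
  intro t ht
  have h0 := hpos t ht
  have hG := auxG_le ha h0 (hr t ht)
  have hGp := auxG_pos ha ‖γ t‖
  have hw := auxW_pos a ‖γ t‖
  apply le_of_sq_le_sq _ (by positivity)
  rw [norm_add_sq_real, norm_smul, norm_smul, inner_smul_left, inner_smul_right,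
    real_inner_comm]
  have hi : inner ℝ (γ t) (deriv γ t) = d t * ‖γ t‖ := by
    simp only [hdd]; field_simp
  have hcs : (d t) ^ 2 ≤ ‖deriv γ t‖ ^ 2 := by
    have h1 := abs_real_inner_le_norm (γ t) (deriv γ t)
    rw [hi, abs_mul, abs_of_pos h0] at h1
    have : |d t| ≤ ‖deriv γ t‖ := by
      apply le_of_mul_le_mul_right _ h0; linarith
    rw [← sq_abs (d t)]; gcongr
  rw [hi]
  simp only [mul_pow, Real.norm_eq_abs, sq_abs, conj_trivial]
  set G := auxG a ‖γ t‖
  set w := auxW a ‖γ t‖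
  set r := ‖γ t‖
  set n := ‖deriv γ t‖
  have hh : G / r ≤ w := by rw [div_le_iff₀ h0]; linarith
  have hh2 : (G / r) ^ 2 ≤ w ^ 2 := by gcongr
  have key : (G / r) ^ 2 * n ^ 2 + 2 * (G / r * ((-w * d t * r - G * d t) / r ^ 2 * (d t * r))) +
      ((-w * d t * r - G * d t) / r ^ 2) ^ 2 * r ^ 2
      = w ^ 2 * (d t) ^ 2 + (G / r) ^ 2 * (n ^ 2 - (d t) ^ 2) := by
    field_simp; ring
  rw [key]
  nlinarith [mul_le_mul_of_nonneg_right hh2 (sub_nonneg.2 hcs)]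

lemma aux_lower {a : ℝ} (ha : 0 < a) {γ : ℝ → V} (hγ : ContDiff ℝ 1 γ) {x : V}
    (h0 : γ 0 = x) (h1 : γ 1 = -x) (hr : ∀ t ∈ Icc (0:ℝ) 1, 1 ≤ a * ‖γ t‖ ^ 2) :
    2 * auxG a ‖x‖ < ∫ t in (0:ℝ)..1, auxW a ‖γ t‖ * ‖deriv γ t‖ := by
  have hne : ∀ t ∈ Icc (0:ℝ) 1, γ t ≠ 0 := by
    intro t ht h
    have := hr t ht
    rw [h] at this; norm_num at this
  have hc : ContinuousOn (fun t => inner ℝ (γ t) x) (Icc (0:ℝ) 1) :=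
    (hγ.continuous.inner continuous_const).continuousOn
  obtain ⟨s, hs, hs0⟩ : ∃ s ∈ Icc (0:ℝ) 1, inner ℝ (γ s) x = 0 := by
    have := intermediate_value_Icc' zero_le_one hc
    apply this
    simp only [h0, h1, inner_neg_left]
    have := real_inner_self_nonneg (x := x)
    constructor <;> linarith
  have A := aux_outer ha hγ hs.1 (fun t ht => hr t ⟨ht.1, ht.2.trans hs.2⟩)
  have B := aux_outer ha hγ hs.2 (fun t ht => hr t ⟨hs.1.trans ht.1, ht.2⟩)
  have hx : x ≠ 0 := h0 ▸ hne 0 (by simp)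
  have hcont := auxW_norm_cont (a := a) hγ
  rw [← intervalIntegral.integral_add_adjacent_intervals (hcont.intervalIntegrable 0 s)
    (hcont.intervalIntegrable s 1)]
  have hq : 0 < ‖auxPhi a (γ s)‖ := by
    rw [auxPhi_norm ha (hne s hs)]; exact auxG_pos ha _
  have hp := auxPhi_norm ha hx
  have horth : inner ℝ (auxPhi a (γ s)) (auxPhi a x) = 0 := by
    simp [auxPhi, inner_smul_left, inner_smul_right, hs0]
  have hneg : auxPhi a (γ 1) = - auxPhi a x := by simp [h1, auxPhi]
  rw [hneg] at B
  rw [h0] at A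
  have e1 : ‖auxPhi a (γ s) - auxPhi a x‖ ^ 2 = ‖auxPhi a (γ s)‖ ^ 2 + auxG a ‖x‖ ^ 2 := by
    rw [norm_sub_sq_real, horth, hp]; ring
  have e2 : ‖-auxPhi a x - auxPhi a (γ s)‖ ^ 2 = ‖auxPhi a (γ s)‖ ^ 2 + auxG a ‖x‖ ^ 2 := by
    rw [norm_sub_sq_real, inner_neg_left, real_inner_comm, horth, norm_neg, hp]; ring
  have f1 : auxG a ‖x‖ < ‖auxPhi a (γ s) - auxPhi a x‖ := by
    apply lt_of_pow_lt_pow_left₀ 2 (norm_nonneg _); rw [e1]; nlinarith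
  have f2 : auxG a ‖x‖ < ‖-auxPhi a x - auxPhi a (γ s)‖ := by
    apply lt_of_pow_lt_pow_left₀ 2 (norm_nonneg _); rw [e2]; nlinarith
  linarith

end lower

section upper
variable {V : Type*} [NormedAddCommGroup V] [InnerProductSpace ℝ V]

def auxS : ℝ → ℝ := Real.smoothTransition

lemma auxS_contDiff : ContDiff ℝ 1 auxS := Real.smoothTransition.contDiff (n := 1)

lemma auxS_deriv (t : ℝ) : HasDerivAt auxS (deriv auxS t) t :=
  ((auxS_contDiff.differentiable one_ne_zero) t).hasDerivAt

lemma auxS_nonneg (t : ℝ) : 0 ≤ deriv auxS t := Real.smoothTransition.monotone.deriv_nonneg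

lemma auxS_zero {t : ℝ} (h : t ≤ 0) : auxS t = 0 := Real.smoothTransition.zero_of_nonpos h
lemma auxS_one {t : ℝ} (h : 1 ≤ t) : auxS t = 1 := Real.smoothTransition.one_of_one_le h

lemma auxS_dzero {t : ℝ} (h : t ≤ 0) : deriv auxS t = 0 := by
  apply IsLocalMin.deriv_eq_zero
  refine Eventually.of_forall fun s => ?_
  rw [auxS_zero h]; exact Real.smoothTransition.nonneg s

lemma auxS_done {t : ℝ} (h : 1 ≤ t) : deriv auxS t = 0 := by
  apply IsLocalMax.deriv_eq_zero
  refine Eventually.of_forall fun s => ?_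
  rw [auxS_one h]; exact Real.smoothTransition.le_one s

lemma aux_curve (a : ℝ) {e f : V} (he : ‖e‖ = 1) (hf : ‖f‖ = 1) (hef : inner ℝ e f = 0)
    {r R : ℝ} (hr : 0 < r) (hR : r < R) :
    ∃ γ : ℝ → V, ContDiff ℝ 1 γ ∧ γ 0 = r • e ∧ γ 1 = -(r • e) ∧
      ∫ t in (0:ℝ)..1, auxW a ‖γ t‖ * ‖deriv γ t‖ ≤
        2 * (auxF a R - auxF a r) + Real.pi * (R * auxW a R) := by
  set ρ : ℝ → ℝ := fun t => r + (R - r) * (auxS (3 * t) - auxS (3 * t - 2)) with hρ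
  set θ : ℝ → ℝ := fun t => Real.pi * auxS (3 * t - 1) with hθ
  set ρ' : ℝ → ℝ := fun t => (R - r) * (3 * deriv auxS (3 * t) - 3 * deriv auxS (3 * t - 2)) with hρ'
  set θ' : ℝ → ℝ := fun t => Real.pi * (3 * deriv auxS (3 * t - 1)) with hθ'
  have dlin : ∀ c t : ℝ, HasDerivAt (fun t => auxS (3 * t - c)) (3 * deriv auxS (3 * t - c)) t := by
    intro c t
    have h1 : HasDerivAt (fun t : ℝ => 3 * t - c) 3 t := by
      simpa using ((hasDerivAt_id t).const_mul (3:ℝ)).sub_const c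
    have := (auxS_deriv (3 * t - c)).comp t h1
    exact this.congr_deriv (by ring)
  have dρ : ∀ t, HasDerivAt ρ (ρ' t) t := by
    intro t
    have h0 := dlin 0 t
    simp only [sub_zero] at h0
    exact ((h0.sub (dlin 2 t)).const_mul (R - r)).const_add r
  have dθ : ∀ t, HasDerivAt θ (θ' t) t := fun t => (dlin 1 t).const_mul _
  have cρ : ContDiff ℝ 1 ρ := by
    have := auxS_contDiff
    exact contDiff_const.add (contDiff_const.mul
      ((this.comp (contDiff_const.mul contDiff_id)).sub
        (this.comp ((contDiff_const.mul contDiff_id).sub contDiff_const))))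
  have cθ : ContDiff ℝ 1 θ := by
    have := auxS_contDiff
    exact contDiff_const.mul (this.comp ((contDiff_const.mul contDiff_id).sub contDiff_const))
  set γ : ℝ → V := fun t => ρ t • (Real.cos (θ t) • e + Real.sin (θ t) • f) with hγ
  have cγ : ContDiff ℝ 1 γ :=
    cρ.smul ((cθ.cos.smul contDiff_const).add (cθ.sin.smul contDiff_const))
  have unit : ∀ c s : ℝ, c ^ 2 + s ^ 2 = 1 → ‖c • e + s • f‖ = 1 := by
    intro c s h
    have : ‖c • e + s • f‖ ^ 2 = 1 := by
      rw [norm_add_sq_real, norm_smul, norm_smul, inner_smul_left, inner_smul_right, hef, he, hf]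
      simp [h]
    nlinarith [norm_nonneg (c • e + s • f)]
  have dγ : ∀ t, HasDerivAt γ (ρ t • ((-Real.sin (θ t) * θ' t) • e + (Real.cos (θ t) * θ' t) • f)
      + ρ' t • (Real.cos (θ t) • e + Real.sin (θ t) • f)) t := fun t =>
    (dρ t).smul (((dθ t).cos.smul_const e).add ((dθ t).sin.smul_const f))
  have S01 : ∀ t, 0 ≤ auxS t ∧ auxS t ≤ 1 := fun t =>
    ⟨Real.smoothTransition.nonneg t, Real.smoothTransition.le_one t⟩
  have ρpos : ∀ t, 0 < ρ t := by
    intro t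
    have h : auxS (3 * t - 2) ≤ auxS (3 * t) := Real.smoothTransition.monotone (by linarith)
    have := mul_nonneg (sub_nonneg.2 hR.le) (sub_nonneg.2 h)
    simp only [hρ]; linarith
  have θnn : ∀ t, 0 ≤ θ' t := fun t =>
    mul_nonneg Real.pi_pos.le (mul_nonneg (by norm_num) (auxS_nonneg _))
  have nγ : ∀ t, ‖γ t‖ = ρ t := by
    intro t
    simp only [hγ]
    rw [norm_smul, unit _ _ (by rw [add_comm]; exact Real.sin_sq_add_cos_sq _), mul_one, Real.norm_of_nonneg (ρpos t).le]
  have ndγ : ∀ t, ‖deriv γ t‖ ≤ ρ t * θ' t + |ρ' t| := by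
    intro t
    rw [(dγ t).deriv]
    refine (norm_add_le _ _).trans ?_
    have e1 : (-Real.sin (θ t) * θ' t) • e + (Real.cos (θ t) * θ' t) • f
      = θ' t • ((-Real.sin (θ t)) • e + Real.cos (θ t) • f) := by
      rw [smul_add, smul_smul, smul_smul]; ring_nf
    rw [e1, norm_smul, norm_smul, norm_smul, unit, unit, Real.norm_of_nonneg (ρpos t).le,
      Real.norm_of_nonneg (θnn t), Real.norm_eq_abs]
    · simp
    · rw [add_comm]; exact Real.sin_sq_add_cos_sq _
    · rw [neg_sq]; exact Real.sin_sq_add_cos_sq _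
  have ang : ∀ t, auxW a (ρ t) * (ρ t * θ' t) = R * auxW a R * θ' t := by
    intro t
    rcases le_or_gt (3 * t - 1) 0 with h | h
    · simp [hθ', auxS_dzero h]
    rcases le_or_gt 1 (3 * t - 1) with h' | h'
    · simp [hθ', auxS_done h']
    have : ρ t = R := by
      simp only [hρ]
      rw [auxS_one (by linarith), auxS_zero (by linarith)]; ring
    rw [this]; ring
  have tot : ∀ t, auxW a ‖γ t‖ * ‖deriv γ t‖ ≤ auxW a (ρ t) * |ρ' t| + R * auxW a R * θ' t := by
    intro t
    rw [nγ, ← ang]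
    nlinarith [mul_le_mul_of_nonneg_left (ndγ t) (auxW_pos a (ρ t)).le]
  have dF : ∀ t, HasDerivAt (fun t => auxF a (ρ t)) (auxW a (ρ t) * ρ' t) t := fun t =>
    (auxF_deriv a (ρ t)).comp t (dρ t)
  have hcont := auxW_norm_cont (a := a) cγ
  have h3 : ∀ t ≤ (1/2:ℝ), 0 ≤ ρ' t := by
    intro t ht
    simp only [hρ']
    rw [auxS_dzero (t := 3 * t - 2) (by linarith)]
    have := auxS_nonneg (3 * t)
    have := sub_pos.2 hR
    simp only [mul_zero, sub_zero]; positivity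
  have h4 : ∀ t ≥ (1/2:ℝ), ρ' t ≤ 0 := by
    intro t ht
    simp only [hρ']
    rw [auxS_done (t := 3 * t) (by linarith)]
    have := auxS_nonneg (3 * t - 2)
    have := sub_pos.2 hR
    apply mul_nonpos_of_nonneg_of_nonpos <;> linarith
  have A := aux_upper (p := 0) (q := 1/2) (by norm_num) hcont
    (fun t _ => (dF t).add ((dθ t).const_mul (R * auxW a R))) (fun t ht => by
      have := tot t
      rw [abs_of_nonneg (h3 t ht.2)] at this
      exact this)
  have B := aux_upper (p := 1/2) (q := 1) (by norm_num) hcont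
    (fun t _ => (dF t).neg.add ((dθ t).const_mul (R * auxW a R))) (fun t ht => by
      have := tot t
      rw [abs_of_nonpos (h4 t ht.1)] at this
      linarith)
  have ρ0 : ρ 0 = r := by
    simp only [hρ]; rw [auxS_zero (by norm_num), auxS_zero (by norm_num)]; ring
  have ρ1 : ρ 1 = r := by
    simp only [hρ]; rw [auxS_one (by norm_num), auxS_one (by norm_num)]; ring
  have ρh : ρ (1/2) = R := by
    simp only [hρ]; rw [auxS_one (by norm_num), auxS_zero (by norm_num)]; ring
  have θ0 : θ 0 = 0 := by
    simp only [hθ]; rw [auxS_zero (by norm_num)]; ring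
  have θ1 : θ 1 = Real.pi := by
    simp only [hθ]; rw [auxS_one (by norm_num)]; ring
  refine ⟨γ, cγ, by simp [hγ, ρ0, θ0], by simp [hγ, ρ1, θ1], ?_⟩
  rw [← intervalIntegral.integral_add_adjacent_intervals (hcont.intervalIntegrable 0 (1/2))
    (hcont.intervalIntegrable (1/2) 1)]
  simp only [Pi.add_apply, Pi.neg_apply, ρ0, ρ1, ρh, θ0, θ1] at A B
  linarith

lemma aux_orth [FiniteDimensional ℝ V] (hV : 2 ≤ Module.finrank ℝ V) (x : V) :
    ∃ f : V, ‖f‖ = 1 ∧ inner ℝ x f = 0 := by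
  have hne : (Submodule.span ℝ {x})ᗮ ≠ ⊥ := by
    intro h
    have h1 := (Submodule.span ℝ {x}).finrank_add_finrank_orthogonal
    rw [h, finrank_bot] at h1
    have h2 : Module.finrank ℝ (Submodule.span ℝ {x}) ≤ 1 := by
      simpa using finrank_span_le_card (R := ℝ) ({x} : Set V)
    omega
  obtain ⟨g, hg, hg0⟩ := Submodule.exists_mem_ne_zero_of_ne_bot hne
  have hi := Submodule.mem_orthogonal_singleton_iff_inner_right.1 hg
  refine ⟨‖g‖⁻¹ • g, ?_, ?_⟩
  · rw [norm_smul, norm_inv, norm_norm, inv_mul_cancel₀ (norm_ne_zero_iff.2 hg0)]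
  · rw [inner_smul_right, hi, mul_zero]

end upper

lemma confLength_eq (m : ℕ) (γ : ℝ → EuclideanSpace ℝ (Fin m)) :
    confLength m γ = ∫ t in (0:ℝ)..1, auxW (1 / (4 * ((m : ℝ) - 2))) ‖γ t‖ * ‖deriv γ t‖ := by
  unfold confLength confWeight auxW
  congr 1; ext t; congr 2; ring

lemma confDist_le {m : ℕ} (hm : 4 ≤ m) {x : EuclideanSpace ℝ (Fin m)} (hx : 0 < ‖x‖) :
    confDist m x (-x) ≤ 2 * auxG (1 / (4 * ((m : ℝ) - 2))) ‖x‖ := by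
  have hm' : (4:ℝ) ≤ m := by exact_mod_cast hm
  have ha : 0 < 1 / (4 * ((m : ℝ) - 2)) := by apply one_div_pos.2; linarith
  set a := 1 / (4 * ((m : ℝ) - 2)) with hadef
  obtain ⟨f, hf, hxf⟩ := aux_orth (by simp; omega) x
  have hl : Tendsto (fun R => 2 * (auxG a ‖x‖ - auxG a R) + Real.pi * (R * auxW a R)) atTop
      (nhds (2 * auxG a ‖x‖)) := by
    simpa using (((auxG_lim ha).const_sub (auxG a ‖x‖)).const_mul 2).add
      ((auxrW_lim ha).const_mul Real.pi)
  refine ge_of_tendsto hl ?_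
  filter_upwards [eventually_gt_atTop ‖x‖] with R hR
  have hxe : ‖x‖ • (‖x‖⁻¹ • x) = x := by rw [smul_smul, mul_inv_cancel₀ hx.ne', one_smul]
  obtain ⟨γ, h1, h2, h3, h4⟩ := aux_curve a (e := ‖x‖⁻¹ • x) (f := f)
    (by rw [norm_smul, norm_inv, norm_norm, inv_mul_cancel₀ hx.ne']) hf
    (by rw [inner_smul_left, hxf, mul_zero]) hx hR
  rw [hxe] at h2 h3
  have hb : BddBelow (Set.range fun γ : {γ : ℝ → EuclideanSpace ℝ (Fin m) //
      ContDiff ℝ 1 γ ∧ γ 0 = x ∧ γ 1 = -x} => confLength m γ.1) := by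
    refine ⟨0, ?_⟩
    rintro _ ⟨γ, rfl⟩
    exact intervalIntegral.integral_nonneg zero_le_one
      (fun t _ => mul_nonneg (Real.exp_pos _).le (norm_nonneg _))
  have := ciInf_le hb ⟨γ, h1, h2, h3⟩
  refine this.trans ?_
  simp only [confLength_eq]
  refine h4.trans (le_of_eq ?_)
  unfold auxG; ring

/-- **The Gaussian soliton with conformally changed metric
`g̃ = e^{-|x|²/(2(m-2))} g_E` has no minimizing geodesics between far-away
antipodal points** : there is `L > 0` such that whenever `‖x‖ > L`, no curve
from `x` to `-x` realizes the `g̃`-distance. -/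
theorem gaussian_soliton_no_minimizing_geodesic (m : ℕ) (hm : 4 ≤ m) :
    ∃ L : ℝ, 0 < L ∧
      ∀ x : EuclideanSpace ℝ (Fin m), L < ‖x‖ →
        ¬ ∃ γ : ℝ → EuclideanSpace ℝ (Fin m),
            ContDiff ℝ 1 γ ∧ γ 0 = x ∧ γ 1 = -x ∧
            confLength m γ = confDist m x (-x) := by
  have hm' : (4:ℝ) ≤ m := by exact_mod_cast hm
  have ha : 0 < 1 / (4 * ((m : ℝ) - 2)) := by apply one_div_pos.2; linarith
  have ha4 : 1 / (4 * ((m : ℝ) - 2)) ≤ 4 := by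
    rw [div_le_iff₀ (by linarith)]; linarith
  have hlen := confLength_eq m
  have hdist := fun x => confDist_le (m := m) hm (x := x)
  set a := 1 / (4 * ((m : ℝ) - 2)) with hadef
  have hW : Tendsto (auxW (2 * a)) atTop (nhds 0) := by
    have h2a : 0 < 2 * a := by linarith
    refine squeeze_zero' (Eventually.of_forall fun r => (auxW_pos _ r).le) ?_ (auxrW_lim h2a)
    filter_upwards [eventually_ge_atTop 1] with r hr
    nlinarith [auxW_pos (2 * a) r]
  have hT : Tendsto (fun r => auxG a r + auxW (2 * a) r / 4) atTop (nhds 0) := by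
    simpa using (auxG_lim ha).add (hW.div_const 4)
  have hev := hT.eventually (gt_mem_nhds (show (0:ℝ) < Real.exp (-2) / 4 by positivity))
  obtain ⟨L, hL⟩ := eventually_atTop.1 hev
  refine ⟨max L 1, by positivity, ?_⟩
  rintro x hx ⟨γ, hγ, h0, h1, hmin⟩
  have hxL : L ≤ ‖x‖ := (le_max_left _ _).trans hx.le
  have hx1 : 0 < ‖x‖ := lt_of_lt_of_le one_pos ((le_max_right _ _).trans hx.le)
  have hd := hdist x hx1
  rw [← hmin, hlen] at hd
  by_cases hr : ∀ t ∈ Icc (0:ℝ) 1, 1 ≤ a * ‖γ t‖ ^ 2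
  · exact absurd (aux_lower ha hγ h0 h1 hr) (not_lt.2 hd)
  · push Not at hr
    obtain ⟨s, hs, hs1⟩ := hr
    have A := aux_core ha ha4 hγ hs.1
    have B := aux_core ha ha4 hγ hs.2
    have hcont := auxW_norm_cont (a := a) hγ
    rw [← intervalIntegral.integral_add_adjacent_intervals (hcont.intervalIntegrable 0 s)
      (hcont.intervalIntegrable s 1)] at hd
    rw [h0] at A
    rw [h1, norm_neg] at B
    have hes : Real.exp (-2) ≤ auxW (2 * a) ‖γ s‖ := by
      unfold auxW
      apply Real.exp_le_exp.2
      linarith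
    have := hL ‖x‖ hxL
    have A' := (le_abs_self _).trans A
    have B' := (neg_le_abs _).trans B
    linarith

end
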